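/- Let 𝔻 ⊂ ℝ² be the open unit disk, α > -1, λ > 0, and K ∈ C¹(𝔻̄) with K > 0 on 𝔻̄. If u ∈ C(𝔻̄) ∩ C²(𝔻 ∖ {0}) satisfies -Δu = λ|y|^{2α} K(y) e^{u} pointwise on 𝔻 ∖ {0} and u = 0 on ∂𝔻, then λ ∫_𝔻 |y|^{2α} K(y) e^{u(y)} dy ≤ 4π ( 2(1+α) + (sup_{y∈𝔻} |∇K(y)|)/(inf_{y∈𝔻} K(y)) ). -/

import Mathlib

open MeasureTheory Real Set Metric

noncomputable section

abbrev Plane := EuclideanSpace ℝ (Fin 2)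

/-- The Laplace operator on ℝ² (acting on real-valued functions). -/
def lap (u : Plane → ℝ) (x : Plane) : ℝ :=
  ∑ i, fderiv ℝ (fun y => fderiv ℝ u y (EuclideanSpace.single i 1)) x
    (EuclideanSpace.single i 1)

/-- `Ω` has smooth boundary: near each boundary point, `Ω` is a sublevel set of a smooth
function with nonvanishing differential, whose zero set is the boundary. -/
def SmoothBoundary (Ω : Set Plane) : Prop :=
  ∀ x ∈ frontier Ω, ∃ (U : Set Plane) (f : Plane → ℝ),
    IsOpen U ∧ x ∈ U ∧ ContDiffOn ℝ (⊤ : ℕ∞) f U ∧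
    (∀ y ∈ U, fderiv ℝ f y ≠ 0) ∧
    Ω ∩ U = {y ∈ U | f y < 0} ∧ frontier Ω ∩ U = {y ∈ U | f y = 0}

/-- Differentiation under the integral sign for an integrand that is `C¹` in the parameter on
the half-line of negative parameters. -/
lemma hasDerivAt_integral_of_neg {G G' : ℝ → ℝ → ℝ}
    (hG : ContinuousOn (Function.uncurry G) (Iio 0 ×ˢ univ))
    (hG' : ContinuousOn (Function.uncurry G') (Iio 0 ×ˢ univ))
    (hd : ∀ t < 0, ∀ θ, HasDerivAt (fun τ => G τ θ) (G' t θ) t) {t : ℝ} (ht : t < 0) (a b : ℝ) :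
    HasDerivAt (fun τ => ∫ θ in a..b, G τ θ) (∫ θ in a..b, G' t θ) t := by
  have slice : ∀ {H : ℝ → ℝ → ℝ}, ContinuousOn (Function.uncurry H) (Iio 0 ×ˢ univ) →
      ∀ τ < 0, Continuous (H τ) := by
    intro H hH τ hτ
    have := hH.comp_continuous (f := fun θ : ℝ => (τ, θ)) (by fun_prop) (fun θ => ⟨hτ, trivial⟩)
    exact this
  have hcpt : IsCompact (Icc (t + t / 2) (t - t / 2) ×ˢ uIcc a b) :=
    isCompact_Icc.prod isCompact_uIcc
  obtain ⟨M, hM⟩ := hcpt.exists_bound_of_continuousOn (f := Function.uncurry G') (hG'.mono (by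
    rintro ⟨x, y⟩ ⟨hx, -⟩
    refine ⟨?_, trivial⟩
    simp only [mem_Icc] at hx
    simp only [mem_Iio]
    linarith [hx.2]))
  have hs : Ioo (t + t / 2) (t - t / 2) ∈ nhds t := Ioo_mem_nhds (by linarith) (by linarith)
  refine (intervalIntegral.hasDerivAt_integral_of_dominated_loc_of_deriv_le (F' := G')
    (bound := fun _ => M) hs ?_ ?_ ?_ ?_ ?_ ?_).2
  · filter_upwards [hs] with τ hτ
    exact (slice hG τ (by linarith [hτ.2])).aestronglyMeasurable
  · exact (slice hG t ht).intervalIntegrable _ _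
  · exact (slice hG' t ht).aestronglyMeasurable
  · refine Filter.Eventually.of_forall fun θ hθ τ hτ => ?_
    exact hM (τ, θ) ⟨Ioo_subset_Icc_self hτ, uIoc_subset_uIcc hθ⟩
  · simp
  · refine Filter.Eventually.of_forall fun θ _ τ hτ => hd τ (by linarith [hτ.2]) θ

/-- The integral of a derivative of a `2 * π`-periodic function over a period vanishes. -/
lemma integral_deriv_periodic {f f' : ℝ → ℝ} (hf : ∀ x, HasDerivAt f (f' x) x)
    (hf' : Continuous f') (hper : ∀ x, f (x + 2 * π) = f x) : ∫ x in (-π)..π, f' x = 0 := by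
  rw [intervalIntegral.integral_eq_sub_of_hasDerivAt (fun x _ => hf x)
    (hf'.intervalIntegrable _ _)]
  have := hper (-π)
  rw [show -π + 2 * π = π by ring] at this
  rw [this, sub_self]

/-- A bounded function on a left half-line cannot have second derivative bounded below by a
positive constant. -/
lemma exists_second_deriv_lt {e e' e'' : ℝ → ℝ} {A T ε : ℝ} (hε : 0 < ε)
    (he : ∀ t < T, HasDerivAt e (e' t) t) (he' : ∀ t < T, HasDerivAt e' (e'' t) t)
    (hA : ∀ t < T, |e t| ≤ A) : ∃ t < T, e'' t < ε := by
  by_contra! hcon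
  have hconv : ConvexOn ℝ (Iio T) (fun t => e t - ε / 2 * t ^ 2) := by
    refine convexOn_of_hasDerivWithinAt2_nonneg (convex_Iio T) (f' := fun t => e' t - ε * t)
      (f'' := fun t => e'' t - ε) ?_ ?_ ?_ ?_
    · intro t ht
      exact ((he t ht).continuousAt.sub (by fun_prop)).continuousWithinAt
    · rw [interior_Iio]
      intro t ht
      refine (((he t ht).sub (((hasDerivAt_id t).pow 2).const_mul (ε / 2))).congr_deriv
        ?_).hasDerivWithinAt
      simp only [id, Nat.cast_ofNat]
      ring
    · rw [interior_Iio]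
      intro t ht
      refine (((he' t ht).sub ((hasDerivAt_id t).const_mul ε)).congr_deriv ?_).hasDerivWithinAt
      simp
    · rw [interior_Iio]
      intro t ht
      linarith [hcon t ht]
  have hA0 : 0 ≤ A := (abs_nonneg _).trans (hA (T - 1) (by linarith))
  set n := 4 * A / ε + 1 with hn
  have hn1 : 1 ≤ n := by
    have : 0 ≤ 4 * A / ε := by positivity
    linarith
  have hmem : T - 1 - 2 * n ∈ Iio T := by
    simp only [mem_Iio]
    linarith
  have key := hconv.2 (show T - 1 ∈ Iio T by simp) hmem (show (0 : ℝ) ≤ 1 / 2 by norm_num)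
    (show (0 : ℝ) ≤ 1 / 2 by norm_num) (by norm_num)
  simp only [smul_eq_mul] at key
  rw [show 1 / 2 * (T - 1) + 1 / 2 * (T - 1 - 2 * n) = T - 1 - n by ring] at key
  have h1 := abs_le.1 (hA (T - 1) (by linarith))
  have h2 := abs_le.1 (hA (T - 1 - 2 * n) (by linarith))
  have h3 := abs_le.1 (hA (T - 1 - n) (by linarith))
  have h4 : ε / 2 * n ^ 2 ≤ 2 * A := by nlinarith
  have h5 : ε * n = 4 * A + ε := by rw [hn]; field_simp
  nlinarith

lemma continuous_slice {H : ℝ → ℝ → ℝ} (hH : ContinuousOn (Function.uncurry H) (Iio 0 ×ˢ univ))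
    {t : ℝ} (ht : t < 0) : Continuous (H t) :=
  hH.comp_continuous (f := fun θ : ℝ => (t, θ)) (by fun_prop) (fun _ => ⟨ht, trivial⟩)

/-- `v` is a classical solution of `v_tt + v_θθ = -f` on the half-cylinder `t < 0`, with `v` and
`f` being `2 * π`-periodic in `θ`; the partial derivatives are recorded as separate functions. -/
structure CylinderSolution (v vt vs vtt vss f : ℝ → ℝ → ℝ) : Prop where
  cont : ContinuousOn (Function.uncurry v) (Iio 0 ×ˢ univ)
  cont_t : ContinuousOn (Function.uncurry vt) (Iio 0 ×ˢ univ)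
  cont_s : ContinuousOn (Function.uncurry vs) (Iio 0 ×ˢ univ)
  cont_tt : ContinuousOn (Function.uncurry vtt) (Iio 0 ×ˢ univ)
  cont_ss : ContinuousOn (Function.uncurry vss) (Iio 0 ×ˢ univ)
  deriv_t : ∀ t < 0, ∀ θ, HasDerivAt (fun τ => v τ θ) (vt t θ) t
  deriv_s : ∀ t < 0, ∀ θ, HasDerivAt (v t) (vs t θ) θ
  deriv_tt : ∀ t < 0, ∀ θ, HasDerivAt (fun τ => vt τ θ) (vtt t θ) t
  deriv_ss : ∀ t < 0, ∀ θ, HasDerivAt (vs t) (vss t θ) θ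
  eqn : ∀ t < 0, ∀ θ, vtt t θ + vss t θ = -f t θ
  periodic : ∀ t, ∀ θ, v t (θ + 2 * π) = v t θ
  periodic_f : ∀ t, ∀ θ, f t (θ + 2 * π) = f t θ

namespace CylinderSolution

variable {v vt vs vtt vss f : ℝ → ℝ → ℝ}

lemma periodic_s (S : CylinderSolution v vt vs vtt vss f) {t : ℝ} (ht : t < 0) (θ : ℝ) :
    vs t (θ + 2 * π) = vs t θ := by
  have h1 := (S.deriv_s t ht (θ + 2 * π)).comp_add_const θ (2 * π)
  simp only [S.periodic] at h1
  exact h1.unique (S.deriv_s t ht θ)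

lemma periodic_t (S : CylinderSolution v vt vs vtt vss f) {t : ℝ} (ht : t < 0) (θ : ℝ) :
    vt t (θ + 2 * π) = vt t θ := by
  have h1 := S.deriv_t t ht (θ + 2 * π)
  simp only [S.periodic] at h1
  exact h1.unique (S.deriv_t t ht θ)

lemma cont_f (S : CylinderSolution v vt vs vtt vss f) :
    ContinuousOn (Function.uncurry f) (Iio 0 ×ˢ univ) := by
  refine (S.cont_tt.add S.cont_ss).neg.congr ?_
  rintro ⟨t, θ⟩ ⟨ht, -⟩
  simp [Function.uncurry, S.eqn t ht θ]

/-- The difference of a solution and its rotation is again a solution. -/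
lemma sub_rotate (S : CylinderSolution v vt vs vtt vss f) (s : ℝ) :
    CylinderSolution (fun t θ => v t (θ + s) - v t θ) (fun t θ => vt t (θ + s) - vt t θ)
      (fun t θ => vs t (θ + s) - vs t θ) (fun t θ => vtt t (θ + s) - vtt t θ)
      (fun t θ => vss t (θ + s) - vss t θ) (fun t θ => f t (θ + s) - f t θ) := by
  have hc : ∀ {H : ℝ → ℝ → ℝ}, ContinuousOn (Function.uncurry H) (Iio 0 ×ˢ univ) →
      ContinuousOn (Function.uncurry fun t θ => H t (θ + s) - H t θ) (Iio 0 ×ˢ univ) := by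
    intro H hH
    refine ContinuousOn.sub ?_ hH
    exact hH.comp (f := fun p : ℝ × ℝ => (p.1, p.2 + s)) (by fun_prop)
      (fun p hp => ⟨hp.1, trivial⟩)
  exact
    { cont := hc S.cont
      cont_t := hc S.cont_t
      cont_s := hc S.cont_s
      cont_tt := hc S.cont_tt
      cont_ss := hc S.cont_ss
      deriv_t := fun t ht θ => (S.deriv_t t ht _).sub (S.deriv_t t ht θ)
      deriv_s := fun t ht θ => ((S.deriv_s t ht _).comp_add_const θ s).sub (S.deriv_s t ht θ)
      deriv_tt := fun t ht θ => (S.deriv_tt t ht _).sub (S.deriv_tt t ht θ)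
      deriv_ss := fun t ht θ => ((S.deriv_ss t ht _).comp_add_const θ s).sub (S.deriv_ss t ht θ)
      eqn := fun t ht θ => by linarith [S.eqn t ht θ, S.eqn t ht (θ + s)]
      periodic := fun t θ => by rw [add_right_comm, S.periodic, S.periodic]
      periodic_f := fun t θ => by rw [add_right_comm, S.periodic_f, S.periodic_f] }

lemma hasDerivAt_sq (S : CylinderSolution v vt vs vtt vss f) {t : ℝ} (ht : t < 0) :
    HasDerivAt (fun τ => ∫ θ in (-π)..π, v τ θ ^ 2) (∫ θ in (-π)..π, 2 * (v t θ * vt t θ)) t := by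
  refine hasDerivAt_integral_of_neg (G := fun t θ => v t θ ^ 2)
    (G' := fun t θ => 2 * (v t θ * vt t θ))
    (by simpa only [Function.uncurry_def] using! S.cont.pow 2)
    ((continuousOn_const (c := (2 : ℝ))).mul (S.cont.mul S.cont_t)) (fun t ht θ => ?_) ht _ _
  refine ((S.deriv_t t ht θ).pow 2).congr_deriv ?_
  norm_num
  ring

lemma hasDerivAt_sq' (S : CylinderSolution v vt vs vtt vss f) {t : ℝ} (ht : t < 0) :
    HasDerivAt (fun τ => ∫ θ in (-π)..π, 2 * (v τ θ * vt τ θ))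
      (∫ θ in (-π)..π, 2 * (vt t θ ^ 2 + vs t θ ^ 2 - v t θ * f t θ)) t := by
  have h1 := hasDerivAt_integral_of_neg (G := fun t θ => 2 * (v t θ * vt t θ))
    (G' := fun t θ => 2 * (vt t θ * vt t θ + v t θ * vtt t θ))
    ((continuousOn_const (c := (2 : ℝ))).mul (S.cont.mul S.cont_t))
    ((continuousOn_const (c := (2 : ℝ))).mul ((S.cont_t.mul S.cont_t).add (S.cont.mul S.cont_tt)))
    (fun t ht θ => ((S.deriv_t t ht θ).mul (S.deriv_tt t ht θ)).const_mul 2) ht (-π) π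
  refine h1.congr_deriv ?_
  have cv := continuous_slice S.cont ht
  have cvt := continuous_slice S.cont_t ht
  have cvs := continuous_slice S.cont_s ht
  have cvtt := continuous_slice S.cont_tt ht
  have cvss := continuous_slice S.cont_ss ht
  have cf := continuous_slice S.cont_f ht
  have h2 : ∫ θ in (-π)..π, 2 * (vs t θ * vs t θ + v t θ * vss t θ) = 0 := by
    refine integral_deriv_periodic (f := fun θ => 2 * (v t θ * vs t θ))
      (fun θ => ((S.deriv_s t ht θ).mul (S.deriv_ss t ht θ)).const_mul 2) (by fun_prop)
      (fun θ => by rw [S.periodic, S.periodic_s ht])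
  rw [← add_zero (intervalIntegral _ _ _ _), ← h2, ← intervalIntegral.integral_add
    (Continuous.intervalIntegrable (by fun_prop) _ _)
    (Continuous.intervalIntegrable (by fun_prop) _ _)]
  refine intervalIntegral.integral_congr fun θ _ => ?_
  have := S.eqn t ht θ
  rw [show f t θ = -(vtt t θ + vss t θ) by linarith]
  ring

/-- Lower bound for the second derivative in `t` of `∫ (v(t, θ + s) - v(t, θ))² dθ`. -/
lemma second_deriv_sub_rotate_ge (S : CylinderSolution v vt vs vtt vss f) {B s t : ℝ} (hs : 0 < s)
    (ht : t < 0) (hB : ∀ θ, |f t θ| ≤ B) :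
    -(π * B ^ 2 * s ^ 2) ≤ ∫ θ in (-π)..π, 2 * ((vt t (θ + s) - vt t θ) ^ 2 +
      (vs t (θ + s) - vs t θ) ^ 2 - (v t (θ + s) - v t θ) * (f t (θ + s) - f t θ)) := by
  have W := S.sub_rotate s
  set w : ℝ → ℝ := fun θ => v t (θ + s) - v t θ with hw
  set ws : ℝ → ℝ := fun θ => vs t (θ + s) - vs t θ with hws
  have cw : Continuous w := continuous_slice W.cont ht
  have cws : Continuous ws := continuous_slice W.cont_s ht
  have cwt : Continuous fun θ => vt t (θ + s) - vt t θ := continuous_slice W.cont_t ht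
  have cv := continuous_slice S.cont ht
  have cvt := continuous_slice S.cont_t ht
  have cvs := continuous_slice S.cont_s ht
  have cf := continuous_slice S.cont_f ht
  set G : ℝ → ℝ := fun θ => ∫ x in θ..(θ + s), f t x with hG
  have hGd : ∀ θ, HasDerivAt G (f t (θ + s) - f t θ) θ := by
    intro θ
    have hQ : ∀ y, HasDerivAt (fun y => ∫ x in (0 : ℝ)..y, f t x) (f t y) y := fun y =>
      cf.integral_hasStrictDerivAt 0 y |>.hasDerivAt
    have := ((hQ (θ + s)).comp_add_const θ s).sub (hQ θ)
    refine this.congr_of_eventuallyEq (Filter.Eventually.of_forall fun y => ?_)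
    exact (intervalIntegral.integral_interval_sub_left (cf.intervalIntegrable _ _)
      (cf.intervalIntegrable _ _)).symm
  have cG : Continuous G := continuous_iff_continuousAt.2 fun θ => (hGd θ).continuousAt
  have hGp : ∀ θ, G (θ + 2 * π) = G θ := by
    intro θ
    have := intervalIntegral.integral_comp_add_right (a := θ) (b := θ + s) (f t) (2 * π)
    simp only [S.periodic_f] at this
    simp only [hG]
    rw [this, add_right_comm]
  have hGb : ∀ θ, |G θ| ≤ B * s := by
    intro θ
    have := intervalIntegral.norm_integral_le_of_norm_le_const (a := θ) (b := θ + s) (f := f t)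
      (C := B) (fun x _ => hB x)
    simpa [abs_of_pos hs] using this
  have h0 : ∫ θ in (-π)..π, 2 * (ws θ * G θ + w θ * (f t (θ + s) - f t θ)) = 0 := by
    refine integral_deriv_periodic (f := fun θ => 2 * (w θ * G θ))
      (fun θ => ((W.deriv_s t ht θ).mul (hGd θ)).const_mul 2) (by fun_prop) (fun θ => ?_)
    have := W.periodic t θ
    simp only [hw, hGp]
    rw [this]
  rw [← add_zero (intervalIntegral _ _ _ _), ← h0, ← intervalIntegral.integral_add
    (Continuous.intervalIntegrable (by fun_prop) _ _)
    (Continuous.intervalIntegrable (by fun_prop) _ _)]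
  have hconst : ∫ _ in (-π)..π, -(B ^ 2 * s ^ 2 / 2) = -(π * B ^ 2 * s ^ 2) := by
    simp
    ring
  rw [← hconst]
  refine intervalIntegral.integral_mono_on (by linarith [pi_pos]) (by simp)
    (Continuous.intervalIntegrable (by fun_prop) _ _) (fun θ _ => ?_)
  have h3 : G θ ^ 2 ≤ (B * s) ^ 2 := sq_le_sq' (by linarith [abs_le.1 (hGb θ)])
    (abs_le.1 (hGb θ)).2
  have h4 : vs t (θ + s) - vs t θ = ws θ := rfl
  rw [h4]
  nlinarith [sq_nonneg (ws θ + G θ / 2), sq_nonneg (vt t (θ + s) - vt t θ)]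

lemma sub_rotate_sq_le (S : CylinderSolution v vt vs vtt vss f) {B s t t₀ : ℝ} (hs : 0 < s)
    (ht₀ : t₀ < t) (ht : t < 0) (hB : ∀ t < 0, ∀ θ, |f t θ| ≤ B)
    (hv : ContinuousOn (Function.uncurry v) (Iic 0 ×ˢ univ)) (hv0 : ∀ θ, v 0 θ = 0) :
    ∫ θ in (-π)..π, (v t (θ + s) - v t θ) ^ 2 ≤
      t / t₀ * ((∫ θ in (-π)..π, (v t₀ (θ + s) - v t₀ θ) ^ 2) +
        π * B ^ 2 * s ^ 2 / 2 * t₀ ^ 2) := by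
  have W := S.sub_rotate s
  have hcont : ContinuousOn (fun t => ∫ θ in (-π)..π, (v t (θ + s) - v t θ) ^ 2) (Iic 0) := by
    have hvm : Continuous (Function.uncurry fun (t θ : ℝ) => v (min t 0) θ) :=
      hv.comp_continuous (f := fun p : ℝ × ℝ => (min p.1 0, p.2)) (by fun_prop)
        (fun p => ⟨min_le_right p.1 0, trivial⟩)
    have : Continuous fun t => ∫ θ in (-π)..π, (v (min t 0) (θ + s) - v (min t 0) θ) ^ 2 := by
      refine intervalIntegral.continuous_parametric_intervalIntegral_of_continuous' ?_ _ _
      refine Continuous.pow (Continuous.sub ?_ hvm) 2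
      exact hvm.comp (f := fun p : ℝ × ℝ => (p.1, p.2 + s)) (by fun_prop)
    refine this.continuousOn.congr fun t ht => ?_
    simp only [min_eq_left (show t ≤ 0 from ht)]
  have hconv : ConvexOn ℝ (Iic 0) (fun t => (∫ θ in (-π)..π, (v t (θ + s) - v t θ) ^ 2) +
      π * B ^ 2 * s ^ 2 / 2 * t ^ 2) := by
    refine convexOn_of_hasDerivWithinAt2_nonneg (convex_Iic 0)
      (f' := fun t => (∫ θ in (-π)..π, 2 * ((v t (θ + s) - v t θ) * (vt t (θ + s) - vt t θ))) +
        π * B ^ 2 * s ^ 2 * t)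
      (f'' := fun t => (∫ θ in (-π)..π, 2 * ((vt t (θ + s) - vt t θ) ^ 2 +
        (vs t (θ + s) - vs t θ) ^ 2 - (v t (θ + s) - v t θ) * (f t (θ + s) - f t θ))) +
        π * B ^ 2 * s ^ 2) ?_ ?_ ?_ ?_
    · exact hcont.add (by fun_prop)
    · rw [interior_Iic]
      intro t ht
      refine (((W.hasDerivAt_sq ht).add (((hasDerivAt_id t).pow 2).const_mul
        (π * B ^ 2 * s ^ 2 / 2))).congr_deriv ?_).hasDerivWithinAt
      simp only [id, Nat.cast_ofNat]
      ring
    · rw [interior_Iic]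
      intro t ht
      refine (((W.hasDerivAt_sq' ht).add ((hasDerivAt_id t).const_mul
        (π * B ^ 2 * s ^ 2))).congr_deriv ?_).hasDerivWithinAt
      simp
    · rw [interior_Iic]
      intro t ht
      linarith [S.second_deriv_sub_rotate_ge hs ht (hB t ht)]
  have hq : 0 ≤ t / t₀ := div_nonneg_of_nonpos ht.le (ht₀.trans ht).le
  have hq1 : t / t₀ ≤ 1 := by
    rw [div_le_one_of_neg (ht₀.trans ht)]
    exact ht₀.le
  have key := hconv.2 (show t₀ ∈ Iic 0 from (ht₀.trans ht).le) (show (0 : ℝ) ∈ Iic 0 by simp)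
    hq (show 0 ≤ 1 - t / t₀ by linarith) (by ring)
  simp only [smul_eq_mul, mul_zero, add_zero, div_mul_cancel₀ t (ht₀.trans ht).ne, hv0] at key
  have hpos : 0 ≤ π * B ^ 2 * s ^ 2 / 2 * t ^ 2 := by positivity
  simp at key
  linarith

/-- The tangential energy of a solution vanishing at `t = 0` decays at least linearly. -/
lemma integral_s_sq_le (S : CylinderSolution v vt vs vtt vss f) {B t t₀ : ℝ}
    (ht₀ : t₀ < t) (ht : t < 0) (hB : ∀ t < 0, ∀ θ, |f t θ| ≤ B)
    (hv : ContinuousOn (Function.uncurry v) (Iic 0 ×ˢ univ)) (hv0 : ∀ θ, v 0 θ = 0) :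
    ∫ θ in (-π)..π, vs t θ ^ 2 ≤
      t / t₀ * ((∫ θ in (-π)..π, vs t₀ θ ^ 2) + π * B ^ 2 / 2 * t₀ ^ 2) := by
  have hlim : ∀ t < 0, Filter.Tendsto
      (fun n : ℕ => ∫ θ in (-π)..π,
        ((v t (θ + 1 / ((n : ℝ) + 1)) - v t θ) / (1 / ((n : ℝ) + 1))) ^ 2)
      Filter.atTop (nhds (∫ θ in (-π)..π, vs t θ ^ 2)) := by
    intro t ht
    have cv := continuous_slice S.cont ht
    have cvs := continuous_slice S.cont_s ht
    obtain ⟨M, hM⟩ := (isCompact_Icc (a := -π) (b := π + 1)).exists_bound_of_continuousOn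
      cvs.continuousOn
    refine intervalIntegral.tendsto_integral_filter_of_dominated_convergence (fun _ => M ^ 2)
      (Filter.Eventually.of_forall fun n => ?_) (Filter.Eventually.of_forall fun n => ?_) (by simp)
      ?_
    · exact Continuous.aestronglyMeasurable (by fun_prop)
    · refine Filter.Eventually.of_forall fun θ hθ => ?_
      rw [uIoc_of_le (by linarith [pi_pos])] at hθ
      have hn : (0 : ℝ) < 1 / ((n : ℝ) + 1) := by positivity
      have hn1 : 1 / ((n : ℝ) + 1) ≤ 1 := by
        rw [div_le_one (by positivity)]
        linarith [(Nat.cast_nonneg n : (0 : ℝ) ≤ n)]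
      have hmv := (convex_Icc (-π) (π + 1)).norm_image_sub_le_of_norm_hasDerivWithin_le
        (f := v t) (f' := vs t) (C := M) (x := θ) (y := θ + 1 / ((n : ℝ) + 1))
        (fun x _ => (S.deriv_s t ht x).hasDerivWithinAt) hM
        ⟨hθ.1.le, by linarith [hθ.2]⟩ ⟨by linarith [hθ.1], by linarith [hθ.2]⟩
      rw [add_sub_cancel_left, Real.norm_eq_abs, Real.norm_eq_abs, abs_of_pos hn] at hmv
      rw [Real.norm_eq_abs, abs_pow, abs_div, abs_of_pos hn]
      gcongr
      rwa [div_le_iff₀ hn]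
    · refine Filter.Eventually.of_forall fun θ _ => ?_
      refine Filter.Tendsto.pow ?_ 2
      have h1 : Filter.Tendsto (fun n : ℕ => 1 / ((n : ℝ) + 1)) Filter.atTop (nhdsWithin 0 {0}ᶜ) :=
        tendsto_nhdsWithin_iff.2 ⟨tendsto_one_div_add_atTop_nhds_zero_nat,
          Filter.Eventually.of_forall fun n => by
            have : (0 : ℝ) < 1 / ((n : ℝ) + 1) := by positivity
            exact this.ne'⟩
      refine ((hasDerivAt_iff_tendsto_slope_zero.1 (S.deriv_s t ht θ)).comp h1).congr fun n => ?_
      simp [div_eq_inv_mul]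
  refine le_of_tendsto_of_tendsto' (hlim t ht)
    (((hlim t₀ (ht₀.trans ht)).add_const (π * B ^ 2 / 2 * t₀ ^ 2)).const_mul (t / t₀)) fun n => ?_
  have hn : (0 : ℝ) < 1 / ((n : ℝ) + 1) := by positivity
  have := S.sub_rotate_sq_le hn ht₀ ht hB hv hv0
  simp only [div_pow, intervalIntegral.integral_div]
  rw [div_le_iff₀ (by positivity)]
  refine this.trans (le_of_eq ?_)
  generalize (∫ θ in (-π)..π, (v t₀ (θ + 1 / ((n : ℝ) + 1)) - v t₀ θ) ^ 2) = I
  field_simp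

lemma exists_energy_lt (S : CylinderSolution v vt vs vtt vss f) {A B β ε T : ℝ} (hβ : 0 < β)
    (hA : ∀ t < 0, ∀ θ, |v t θ| ≤ A) (hf0 : ∀ t < 0, ∀ θ, 0 ≤ f t θ)
    (hfB : ∀ t < 0, ∀ θ, f t θ ≤ B * exp (β * t)) (hε : 0 < ε) (hT : T < 0) :
    ∃ t < T, ∫ θ in (-π)..π, (vt t θ ^ 2 + vs t θ ^ 2) < ε ∧ ∫ θ in (-π)..π, f t θ < ε := by
  have hA0 : 0 ≤ A := (abs_nonneg _).trans (hA (-1) (by norm_num) 0)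
  have hlim : Filter.Tendsto (fun t => 2 * π * (A + 1) * B * exp (β * t)) Filter.atBot
      (nhds (2 * π * (A + 1) * B * 0)) :=
    (tendsto_exp_atBot.comp (Filter.tendsto_id.const_mul_atBot hβ)).const_mul _
  rw [mul_zero] at hlim
  obtain ⟨T', hT'⟩ := Filter.eventually_atBot.1 (hlim.eventually (gt_mem_nhds (half_pos hε)))
  have hint : ∀ t < 0, ∫ θ in (-π)..π, f t θ ≤ 2 * π * (B * exp (β * t)) := by
    intro t ht
    have h1 : ∫ θ in (-π)..π, f t θ ≤ ∫ _ in (-π)..π, B * exp (β * t) :=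
      intervalIntegral.integral_mono_on (by linarith [pi_pos])
        ((continuous_slice S.cont_f ht).intervalIntegrable _ _) (by simp)
        (fun θ _ => hfB t ht θ)
    refine h1.trans (le_of_eq ?_)
    simp
    ring
  obtain ⟨t, htT, hlt⟩ := exists_second_deriv_lt (T := min T T') (A := 2 * π * A ^ 2) hε
    (fun t ht => S.hasDerivAt_sq (ht.trans_le ((min_le_left _ _).trans hT.le)))
    (fun t ht => S.hasDerivAt_sq' (ht.trans_le ((min_le_left _ _).trans hT.le)))
    (by
      intro t ht
      have ht0 : t < 0 := ht.trans_le ((min_le_left _ _).trans hT.le)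
      have := intervalIntegral.norm_integral_le_of_norm_le_const (a := -π) (b := π)
        (f := fun θ => v t θ ^ 2) (C := A ^ 2) (fun θ _ => by
          rw [Real.norm_eq_abs, abs_pow]
          exact pow_le_pow_left₀ (abs_nonneg _) (hA t ht0 θ) 2)
      rw [Real.norm_eq_abs, abs_of_pos (show 0 < π - -π by linarith [pi_pos])] at this
      linarith)
  have ht0 : t < 0 := htT.trans_le ((min_le_left _ _).trans hT.le)
  have hB0 : 0 ≤ B * exp (β * t) := (hf0 t ht0 0).trans (hfB t ht0 0)
  have hsmall := hT' t (htT.trans_le (min_le_right _ _)).le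
  have hmain := hint t ht0
  have cv := continuous_slice S.cont ht0
  have cvt := continuous_slice S.cont_t ht0
  have cvs := continuous_slice S.cont_s ht0
  have cf := continuous_slice S.cont_f ht0
  have hpA : 0 ≤ π * A * (B * exp (β * t)) := by positivity
  have hp : 0 ≤ π * (B * exp (β * t)) := by positivity
  refine ⟨t, htT.trans_le (min_le_left _ _), ?_, by nlinarith⟩
  have h2 : ∫ θ in (-π)..π, 2 * (vt t θ ^ 2 + vs t θ ^ 2 - A * f t θ) ≤
      ∫ θ in (-π)..π, 2 * (vt t θ ^ 2 + vs t θ ^ 2 - v t θ * f t θ) := by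
    refine intervalIntegral.integral_mono_on (by linarith [pi_pos])
      (Continuous.intervalIntegrable (by fun_prop) _ _)
      (Continuous.intervalIntegrable (by fun_prop) _ _) (fun θ _ => ?_)
    have := mul_le_mul_of_nonneg_right (abs_le.1 (hA t ht0 θ)).2 (hf0 t ht0 θ)
    linarith
  rw [intervalIntegral.integral_const_mul, intervalIntegral.integral_sub
    (Continuous.intervalIntegrable (by fun_prop) _ _)
    (Continuous.intervalIntegrable (by fun_prop) _ _), intervalIntegral.integral_const_mul] at h2
  have h3 := mul_le_mul_of_nonneg_left hmain hA0
  nlinarith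

end CylinderSolution

/-- The Cauchy-Schwarz inequality on a circle. -/
lemma sq_integral_le_two_pi_mul {g : ℝ → ℝ} (hg : Continuous g) :
    (∫ θ in (-π)..π, g θ) ^ 2 ≤ 2 * π * ∫ θ in (-π)..π, g θ ^ 2 := by
  set c := (∫ θ in (-π)..π, g θ) / (2 * π) with hc
  have h0 : 0 ≤ ∫ θ in (-π)..π, (g θ ^ 2 - 2 * c * g θ + c ^ 2) :=
    intervalIntegral.integral_nonneg (by linarith [pi_pos])
      (fun θ _ => by nlinarith [sq_nonneg (g θ - c)])
  rw [intervalIntegral.integral_add (Continuous.intervalIntegrable (by fun_prop) _ _)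
    (Continuous.intervalIntegrable (by fun_prop) _ _), intervalIntegral.integral_sub
    (Continuous.intervalIntegrable (by fun_prop) _ _)
    (Continuous.intervalIntegrable (by fun_prop) _ _), intervalIntegral.integral_const_mul,
    intervalIntegral.integral_const, smul_eq_mul] at h0
  have hcI : ∫ θ in (-π)..π, g θ = c * (2 * π) := by
    rw [hc]
    field_simp
  rw [hcI] at h0 ⊢
  nlinarith [pi_pos, mul_le_mul_of_nonneg_left h0 (show 0 ≤ 2 * π by positivity)]

namespace CylinderSolution

variable {v vt vs vtt vss f : ℝ → ℝ → ℝ}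

lemma hasDerivAt_flux (S : CylinderSolution v vt vs vtt vss f) {t : ℝ} (ht : t < 0) :
    HasDerivAt (fun τ => -∫ θ in (-π)..π, vt τ θ) (∫ θ in (-π)..π, f t θ) t := by
  refine (hasDerivAt_integral_of_neg S.cont_t S.cont_tt S.deriv_tt ht (-π) π).neg.congr_deriv ?_
  have h0 : ∫ θ in (-π)..π, vss t θ = 0 :=
    integral_deriv_periodic (S.deriv_ss t ht) (continuous_slice S.cont_ss ht) (S.periodic_s ht)
  rw [← add_zero (∫ θ in (-π)..π, vtt t θ), ← h0, ← intervalIntegral.integral_add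
    ((continuous_slice S.cont_tt ht).intervalIntegrable _ _)
    ((continuous_slice S.cont_ss ht).intervalIntegrable _ _), ← intervalIntegral.integral_neg]
  refine intervalIntegral.integral_congr fun θ _ => ?_
  linarith [S.eqn t ht θ]

/-- The Pohozaev identity on the cylinder. -/
lemma hasDerivAt_pohozaev (S : CylinderSolution v vt vs vtt vss f) {vts q : ℝ → ℝ → ℝ}
    (cont_ts : ContinuousOn (Function.uncurry vts) (Iio 0 ×ˢ univ))
    (deriv_ts : ∀ t < 0, ∀ θ, HasDerivAt (vt t) (vts t θ) θ)
    (deriv_st : ∀ t < 0, ∀ θ, HasDerivAt (fun τ => vs τ θ) (vts t θ) t)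
    (cont_q : ContinuousOn (Function.uncurry q) (Iio 0 ×ˢ univ))
    (deriv_f : ∀ t < 0, ∀ θ, HasDerivAt (fun τ => f τ θ) (f t θ * vt t θ + q t θ) t)
    {t : ℝ} (ht : t < 0) :
    HasDerivAt (fun τ => ∫ θ in (-π)..π, ((vt τ θ * vt τ θ - vs τ θ * vs τ θ) / 2 + f τ θ))
      (∫ θ in (-π)..π, q t θ) t := by
  have h1 := hasDerivAt_integral_of_neg
    (G := fun t θ => (vt t θ * vt t θ - vs t θ * vs t θ) / 2 + f t θ)
    (G' := fun t θ => (vt t θ * vtt t θ - vs t θ * vts t θ) + (f t θ * vt t θ + q t θ))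
    ((((S.cont_t.mul S.cont_t).sub (S.cont_s.mul S.cont_s)).div_const 2).add S.cont_f)
    (((S.cont_t.mul S.cont_tt).sub (S.cont_s.mul cont_ts)).add
      ((S.cont_f.mul S.cont_t).add cont_q))
    (fun t ht θ => ((((((S.deriv_tt t ht θ).mul (S.deriv_tt t ht θ)).sub
      ((deriv_st t ht θ).mul (deriv_st t ht θ))).div_const 2).add (deriv_f t ht θ)).congr_deriv
        (by ring))) ht (-π) π
  refine h1.congr_deriv ?_
  have cvt := continuous_slice S.cont_t ht
  have cvs := continuous_slice S.cont_s ht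
  have cvtt := continuous_slice S.cont_tt ht
  have cvss := continuous_slice S.cont_ss ht
  have cvts := continuous_slice cont_ts ht
  have cf := continuous_slice S.cont_f ht
  have cq := continuous_slice cont_q ht
  have h0 : ∫ θ in (-π)..π, (vss t θ * vt t θ + vs t θ * vts t θ) = 0 :=
    integral_deriv_periodic (f := fun θ => vs t θ * vt t θ)
      (fun θ => (S.deriv_ss t ht θ).mul (deriv_ts t ht θ)) (by fun_prop)
      (fun θ => by rw [S.periodic_s ht, S.periodic_t ht])
  rw [← add_zero (intervalIntegral _ _ _ _), ← h0, ← intervalIntegral.integral_add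
    (Continuous.intervalIntegrable (by fun_prop) _ _)
    (Continuous.intervalIntegrable (by fun_prop) _ _)]
  refine intervalIntegral.integral_congr fun θ _ => ?_
  rw [show f t θ = -(vtt t θ + vss t θ) by linarith [S.eqn t ht θ]]
  ring

/-- Consequences of the Pohozaev identity for the flux of a bounded solution whose right-hand side
decays exponentially at `-∞`. -/
lemma flux_bounds (S : CylinderSolution v vt vs vtt vss f) {vts q : ℝ → ℝ → ℝ}
    (cont_ts : ContinuousOn (Function.uncurry vts) (Iio 0 ×ˢ univ))
    (deriv_ts : ∀ t < 0, ∀ θ, HasDerivAt (vt t) (vts t θ) θ)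
    (deriv_st : ∀ t < 0, ∀ θ, HasDerivAt (fun τ => vs τ θ) (vts t θ) t)
    (cont_q : ContinuousOn (Function.uncurry q) (Iio 0 ×ˢ univ))
    (deriv_f : ∀ t < 0, ∀ θ, HasDerivAt (fun τ => f τ θ) (f t θ * vt t θ + q t θ) t)
    {A B C β : ℝ} (hβ : 0 < β) (hC : 0 ≤ C)
    (hA : ∀ t < 0, ∀ θ, |v t θ| ≤ A) (hf0 : ∀ t < 0, ∀ θ, 0 ≤ f t θ)
    (hfB : ∀ t < 0, ∀ θ, f t θ ≤ B * exp (β * t)) (hq : ∀ t < 0, ∀ θ, q t θ ≤ C * f t θ)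
    {t : ℝ} (ht : t < 0) :
    0 ≤ -∫ θ in (-π)..π, vt t θ ∧
      (-∫ θ in (-π)..π, vt t θ) ^ 2 ≤
        4 * π * C * (-∫ θ in (-π)..π, vt t θ) + 2 * π * ∫ θ in (-π)..π, vs t θ ^ 2 := by
  set m : ℝ → ℝ := fun t => -∫ θ in (-π)..π, vt t θ with hm
  set P : ℝ → ℝ := fun t =>
    ∫ θ in (-π)..π, ((vt t θ * vt t θ - vs t θ * vs t θ) / 2 + f t θ) with hP
  have hmono : MonotoneOn m (Iio 0) := by
    refine monotoneOn_of_hasDerivWithinAt_nonneg (convex_Iio 0)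
      (f' := fun t => ∫ θ in (-π)..π, f t θ)
      (fun t ht => (S.hasDerivAt_flux ht).continuousAt.continuousWithinAt) ?_ ?_
    · rw [interior_Iio]
      exact fun t ht => (S.hasDerivAt_flux ht).hasDerivWithinAt
    · rw [interior_Iio]
      exact fun t ht => intervalIntegral.integral_nonneg (by linarith [pi_pos])
        (fun θ _ => hf0 t ht θ)
  have hD : ∀ t < 0, HasDerivAt (fun t => P t - C * m t)
      ((∫ θ in (-π)..π, q t θ) - C * ∫ θ in (-π)..π, f t θ) t := fun t ht =>
    (S.hasDerivAt_pohozaev cont_ts deriv_ts deriv_st cont_q deriv_f ht).sub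
      ((S.hasDerivAt_flux ht).const_mul C)
  have hanti : AntitoneOn (fun t => P t - C * m t) (Iio 0) := by
    refine antitoneOn_of_hasDerivWithinAt_nonpos (convex_Iio 0)
      (f' := fun t => (∫ θ in (-π)..π, q t θ) - C * ∫ θ in (-π)..π, f t θ)
      (fun t ht => (hD t ht).continuousAt.continuousWithinAt) ?_ ?_
    · rw [interior_Iio]
      exact fun t ht => (hD t ht).hasDerivWithinAt
    · rw [interior_Iio]
      intro t ht
      rw [sub_nonpos, ← intervalIntegral.integral_const_mul]
      exact intervalIntegral.integral_mono_on (by linarith [pi_pos])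
        ((continuous_slice cont_q ht).intervalIntegrable _ _)
        (((continuous_slice S.cont_f ht).const_mul C).intervalIntegrable _ _)
        (fun θ _ => hq t ht θ)
  have hsplit : ∀ t < 0, 2 * P t = (∫ θ in (-π)..π, vt t θ ^ 2) - (∫ θ in (-π)..π, vs t θ ^ 2) +
      2 * ∫ θ in (-π)..π, f t θ := by
    intro t ht
    have cvt := continuous_slice S.cont_t ht
    have cvs := continuous_slice S.cont_s ht
    have cf := continuous_slice S.cont_f ht
    rw [← intervalIntegral.integral_sub (Continuous.intervalIntegrable (by fun_prop) _ _)
      (Continuous.intervalIntegrable (by fun_prop) _ _), ← intervalIntegral.integral_const_mul,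
      ← intervalIntegral.integral_const_mul,
      ← intervalIntegral.integral_add (Continuous.intervalIntegrable (by fun_prop) _ _)
      (Continuous.intervalIntegrable (by fun_prop) _ _)]
    refine intervalIntegral.integral_congr fun θ _ => ?_
    ring
  have hCS : ∀ t < 0, m t ^ 2 ≤ 2 * π * ∫ θ in (-π)..π, vt t θ ^ 2 := by
    intro t ht
    rw [hm, neg_sq]
    exact sq_integral_le_two_pi_mul (continuous_slice S.cont_t ht)
  have hsmall : ∀ η > 0, ∃ t' < t, |m t'| ≤ 3 * η ∧ P t' ≤ 2 * η ^ 2 := by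
    intro η hη
    obtain ⟨t', ht', h1, h2⟩ := S.exists_energy_lt hβ hA hf0 hfB (sq_pos_of_pos hη) ht
    have ht'0 := ht'.trans ht
    have cvt := continuous_slice S.cont_t ht'0
    have cvs := continuous_slice S.cont_s ht'0
    rw [intervalIntegral.integral_add (Continuous.intervalIntegrable (by fun_prop) _ _)
      (Continuous.intervalIntegrable (by fun_prop) _ _)] at h1
    have h3 : 0 ≤ ∫ θ in (-π)..π, vs t' θ ^ 2 :=
      intervalIntegral.integral_nonneg (by linarith [pi_pos]) (fun θ _ => sq_nonneg _)
    refine ⟨t', ht', abs_le_of_sq_le_sq ?_ (by positivity), by nlinarith [hsplit t' ht'0]⟩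
    have h4 := hCS t' ht'0
    have h5 : 2 * π * ∫ θ in (-π)..π, vt t' θ ^ 2 ≤ 2 * π * η ^ 2 :=
      mul_le_mul_of_nonneg_left (by linarith) (by positivity)
    nlinarith [pi_lt_four, sq_nonneg η]
  have hm0 : 0 ≤ m t := by
    refine le_of_forall_pos_le_add fun δ hδ => ?_
    obtain ⟨t', ht', h1, -⟩ := hsmall (δ / 3) (by positivity)
    have := hmono (show t' ∈ Iio 0 from ht'.trans ht) ht ht'.le
    linarith [(abs_le.1 h1).1]
  have hPm : P t - C * m t ≤ 0 := by
    refine le_of_forall_pos_le_add fun δ hδ => ?_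
    have hη : 0 < min 1 (δ / (2 + 3 * C)) := by positivity
    obtain ⟨t', ht', h1, h2⟩ := hsmall _ hη
    set η := min 1 (δ / (2 + 3 * C))
    have h3 : P t - C * m t ≤ P t' - C * m t' := hanti (show t' ∈ Iio 0 from ht'.trans ht) ht ht'.le
    have h4 : -(C * m t') ≤ C * (3 * η) := by
      rw [← mul_neg]
      exact mul_le_mul_of_nonneg_left (by linarith [(abs_le.1 h1).1]) hC
    have h5 : η ≤ 1 := min_le_left _ _
    have h6 : η * (2 + 3 * C) ≤ δ := by
      rw [← le_div_iff₀ (by positivity)]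
      exact min_le_right _ _
    nlinarith
  refine ⟨hm0, (hCS t ht).trans ?_⟩
  have h1 : 0 ≤ ∫ θ in (-π)..π, f t θ :=
    intervalIntegral.integral_nonneg (by linarith [pi_pos]) (fun θ _ => hf0 t ht θ)
  have h2 : ∫ θ in (-π)..π, vt t θ ^ 2 ≤ 2 * (C * m t) + ∫ θ in (-π)..π, vs t θ ^ 2 := by
    linarith [hsplit t ht]
  have h3 := mul_le_mul_of_nonneg_left h2 (show 0 ≤ 2 * π by positivity)
  linarith

/-- The flux of a bounded solution vanishing at `t = 0` is nonnegative and at most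
`4 * π * C`, where `C` controls the derivative of `log f - v` in `t`. -/
lemma flux_nonneg_and_le (S : CylinderSolution v vt vs vtt vss f) {vts q : ℝ → ℝ → ℝ}
    (cont_ts : ContinuousOn (Function.uncurry vts) (Iio 0 ×ˢ univ))
    (deriv_ts : ∀ t < 0, ∀ θ, HasDerivAt (vt t) (vts t θ) θ)
    (deriv_st : ∀ t < 0, ∀ θ, HasDerivAt (fun τ => vs τ θ) (vts t θ) t)
    (cont_q : ContinuousOn (Function.uncurry q) (Iio 0 ×ˢ univ))
    (deriv_f : ∀ t < 0, ∀ θ, HasDerivAt (fun τ => f τ θ) (f t θ * vt t θ + q t θ) t)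
    {A B C β : ℝ} (hβ : 0 < β) (hC : 0 ≤ C)
    (hA : ∀ t < 0, ∀ θ, |v t θ| ≤ A) (hf0 : ∀ t < 0, ∀ θ, 0 ≤ f t θ)
    (hfB : ∀ t < 0, ∀ θ, f t θ ≤ B * exp (β * t)) (hq : ∀ t < 0, ∀ θ, q t θ ≤ C * f t θ)
    (hv : ContinuousOn (Function.uncurry v) (Iic 0 ×ˢ univ)) (hv0 : ∀ θ, v 0 θ = 0) :
    ∀ t < 0, 0 ≤ -∫ θ in (-π)..π, vt t θ ∧ -∫ θ in (-π)..π, vt t θ ≤ 4 * π * C := by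
  intro t ht
  set m : ℝ → ℝ := fun t => -∫ θ in (-π)..π, vt t θ with hm
  have hmono : MonotoneOn m (Iio 0) := by
    refine monotoneOn_of_hasDerivWithinAt_nonneg (convex_Iio 0)
      (f' := fun t => ∫ θ in (-π)..π, f t θ)
      (fun t ht => (S.hasDerivAt_flux ht).continuousAt.continuousWithinAt) ?_ ?_
    · rw [interior_Iio]
      exact fun t ht => (S.hasDerivAt_flux ht).hasDerivWithinAt
    · rw [interior_Iio]
      exact fun t ht => intervalIntegral.integral_nonneg (by linarith [pi_pos])
        (fun θ _ => hf0 t ht θ)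
  have hbounds := fun t (ht : t < 0) => S.flux_bounds cont_ts deriv_ts deriv_st cont_q deriv_f hβ hC
    hA hf0 hfB hq ht
  have hfB' : ∀ t < 0, ∀ θ, |f t θ| ≤ B := by
    intro t ht θ
    have hB : 0 ≤ B := by
      have := (hf0 t ht θ).trans (hfB t ht θ)
      exact nonneg_of_mul_nonneg_left this (exp_pos _)
    rw [abs_of_nonneg (hf0 t ht θ)]
    refine (hfB t ht θ).trans (mul_le_of_le_one_right hB ?_)
    rw [exp_le_one_iff]
    nlinarith
  refine ⟨(hbounds t ht).1, ?_⟩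
  by_contra! hcon
  set D := (∫ θ in (-π)..π, vs t θ ^ 2) + π * B ^ 2 / 2 * t ^ 2
  have hlim : Filter.Tendsto (fun τ => 2 * π * (τ / t * D)) (nhdsWithin 0 (Ioo t 0))
      (nhds (2 * π * (0 / t * D))) :=
    (Continuous.tendsto (by fun_prop) 0).mono_left nhdsWithin_le_nhds
  rw [zero_div, zero_mul, mul_zero] at hlim
  have : (nhdsWithin 0 (Ioo t 0)).NeBot := right_nhdsWithin_Ioo_neBot ht
  have hle : m t * (m t - 4 * π * C) ≤ 0 := by
    refine ge_of_tendsto hlim (eventually_nhdsWithin_of_forall fun τ hτ => ?_)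
    have h1 : m t ≤ m τ := hmono ht hτ.2 hτ.1.le
    have h2 := (hbounds τ hτ.2).2
    have h3 : 2 * π * ∫ θ in (-π)..π, vs τ θ ^ 2 ≤ 2 * π * (τ / t * D) :=
      mul_le_mul_of_nonneg_left (S.integral_s_sq_le hτ.1 hτ.2 hfB' hv hv0)
      (show 0 ≤ 2 * π by positivity)
    have h4 : m t * (m t - 4 * π * C) ≤ m τ * (m τ - 4 * π * C) :=
      mul_le_mul h1 (by linarith) (by linarith) ((hbounds t ht).1.trans h1)
    have h5 : m τ ^ 2 ≤ 4 * π * C * m τ + 2 * π * ∫ θ in (-π)..π, vs τ θ ^ 2 := h2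
    calc m t * (m t - 4 * π * C) ≤ m τ * (m τ - 4 * π * C) := h4
      _ = m τ ^ 2 - 4 * π * C * m τ := by ring
      _ ≤ 2 * π * ∫ θ in (-π)..π, vs τ θ ^ 2 := by linarith
      _ ≤ _ := h3
  have hpos : 0 < m t := lt_of_le_of_lt (by positivity) hcon
  nlinarith [mul_pos hpos (sub_pos.2 hcon)]

end CylinderSolution

/-- Logarithmic polar coordinates on the plane. -/
def logPolar (t θ : ℝ) : Plane :=
  (exp t * cos θ) • EuclideanSpace.single 0 1 + (exp t * sin θ) • EuclideanSpace.single 1 1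

lemma norm_logPolar (t θ : ℝ) : ‖logPolar t θ‖ = exp t := by
  rw [logPolar, EuclideanSpace.norm_eq, Fin.sum_univ_two]
  simp only [PiLp.add_apply, PiLp.smul_apply, PiLp.single_apply, smul_eq_mul]
  simp [mul_pow]
  rw [← mul_add, cos_sq_add_sin_sq, mul_one, sqrt_sq (exp_pos t).le]

lemma logPolar_mem {t : ℝ} (ht : t < 0) (θ : ℝ) : logPolar t θ ∈ ball (0 : Plane) 1 \ {0} := by
  refine ⟨by simpa [norm_logPolar] using ht, fun h => ?_⟩
  have := norm_logPolar t θ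
  rw [mem_singleton_iff.1 h, norm_zero] at this
  exact (exp_pos t).ne this

lemma logPolar_periodic (t θ : ℝ) : logPolar t (θ + 2 * π) = logPolar t θ := by
  simp [logPolar]

lemma continuous_logPolar : Continuous fun p : ℝ × ℝ => logPolar p.1 p.2 := by
  unfold logPolar
  fun_prop

lemma continuousOn_comp_logPolar {g : Plane → ℝ} (hg : ContinuousOn g (ball 0 1 \ {0})) :
    ContinuousOn (Function.uncurry fun t θ => g (logPolar t θ)) (Iio 0 ×ˢ univ) :=
  hg.comp continuous_logPolar.continuousOn fun p hp => logPolar_mem hp.1 p.2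

lemma hasDerivAt_comp_logPolar_left {g : Plane → ℝ} {t θ : ℝ}
    (hg : DifferentiableAt ℝ g (logPolar t θ)) :
    HasDerivAt (fun τ => g (logPolar τ θ))
      (fderiv ℝ g (logPolar t θ) (EuclideanSpace.single 0 1) * (exp t * cos θ) +
        fderiv ℝ g (logPolar t θ) (EuclideanSpace.single 1 1) * (exp t * sin θ)) t := by
  have h1 : HasDerivAt (fun τ => logPolar τ θ) (logPolar t θ) t :=
    (((Real.hasDerivAt_exp t).mul_const (cos θ)).smul_const _).add
      (((Real.hasDerivAt_exp t).mul_const (sin θ)).smul_const _)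
  refine (hg.hasFDerivAt.comp_hasDerivAt t h1).congr_deriv ?_
  conv_lhs => rw [logPolar.eq_def t θ, map_add, map_smul, map_smul, ← logPolar.eq_def]
  simp only [smul_eq_mul]
  ring

lemma hasDerivAt_comp_logPolar_right {g : Plane → ℝ} {t θ : ℝ}
    (hg : DifferentiableAt ℝ g (logPolar t θ)) :
    HasDerivAt (fun φ => g (logPolar t φ))
      (-(fderiv ℝ g (logPolar t θ) (EuclideanSpace.single 0 1) * (exp t * sin θ)) +
        fderiv ℝ g (logPolar t θ) (EuclideanSpace.single 1 1) * (exp t * cos θ)) θ := by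
  have h1 : HasDerivAt (fun φ => logPolar t φ) ((exp t * -sin θ) • EuclideanSpace.single 0 1 +
      (exp t * cos θ) • EuclideanSpace.single 1 1) θ :=
    (((Real.hasDerivAt_cos θ).const_mul (exp t)).smul_const _).add
      (((Real.hasDerivAt_sin θ).const_mul (exp t)).smul_const _)
  refine (hg.hasFDerivAt.comp_hasDerivAt θ h1).congr_deriv ?_
  rw [map_add, map_smul, map_smul]
  simp only [smul_eq_mul]
  ring

/-- The partial derivatives of a function on the plane. -/
def partialDeriv (i : Fin 2) (u : Plane → ℝ) (y : Plane) : ℝ :=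
  fderiv ℝ u y (EuclideanSpace.single i 1)

lemma lap_eq_partialDeriv (u : Plane → ℝ) (y : Plane) :
    lap u y = partialDeriv 0 (partialDeriv 0 u) y + partialDeriv 1 (partialDeriv 1 u) y := by
  rw [lap, Fin.sum_univ_two]
  rfl

lemma isOpen_punctured : IsOpen (ball (0 : Plane) 1 \ {0}) := isOpen_ball.sdiff isClosed_singleton

lemma contDiffOn_partialDeriv {u : Plane → ℝ} (hu : ContDiffOn ℝ 2 u (ball 0 1 \ {0}))
    (i : Fin 2) : ContDiffOn ℝ 1 (partialDeriv i u) (ball 0 1 \ {0}) :=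
  (hu.fderiv_of_isOpen isOpen_punctured (by norm_num)).clm_apply contDiffOn_const

lemma continuousOn_partialDeriv {u : Plane → ℝ} (hu : ContDiffOn ℝ 1 u (ball 0 1 \ {0}))
    (i : Fin 2) : ContinuousOn (partialDeriv i u) (ball 0 1 \ {0}) :=
  (hu.continuousOn_fderiv_of_isOpen isOpen_punctured le_rfl).clm_apply continuousOn_const

lemma partialDeriv_comm {u : Plane → ℝ} (hu : ContDiffOn ℝ 2 u (ball 0 1 \ {0})) {y : Plane}
    (hy : y ∈ ball (0 : Plane) 1 \ {0}) (i j : Fin 2) :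
    partialDeriv i (partialDeriv j u) y = partialDeriv j (partialDeriv i u) y := by
  have hat : ContDiffAt ℝ 2 u y := hu.contDiffAt (isOpen_punctured.mem_nhds hy)
  have hsymm : IsSymmSndFDerivAt ℝ u y := hat.isSymmSndFDerivAt (by simp)
  have hd : DifferentiableAt ℝ (fderiv ℝ u) y :=
    (hat.fderiv_right (m := 1) (by norm_num)).differentiableAt (by norm_num)
  have h : ∀ i j : Fin 2, partialDeriv i (partialDeriv j u) y =
      fderiv ℝ (fderiv ℝ u) y (EuclideanSpace.single i 1) (EuclideanSpace.single j 1) := by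
    intro i j
    unfold partialDeriv
    rw [fderiv_clm_apply hd (by fun_prop)]
    simp
  rw [h, h, hsymm]

lemma orthonormalBasisOneI_repr_polarCoord_symm {r : ℝ} (hr : 0 < r) (θ : ℝ) :
    Complex.orthonormalBasisOneI.repr (Complex.polarCoord.symm (r, θ)) = logPolar (log r) θ := by
  ext i
  fin_cases i <;> simp [logPolar, exp_log hr, Complex.cos_ofReal_re, Complex.sin_ofReal_re]

/-- Integration over the unit disk in polar coordinates. -/
lemma setIntegral_ball_eq_logPolar (g : Plane → ℝ) :
    ∫ y in ball (0 : Plane) 1, g y =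
      ∫ p in Ioo (0 : ℝ) 1 ×ˢ Ioo (-π) π, p.1 * g (logPolar (log p.1) p.2) := by
  set L := Complex.orthonormalBasisOneI.repr with hL
  have h1 : ∫ y in ball (0 : Plane) 1, g y = ∫ z in ball (0 : ℂ) 1, g (L z) := by
    rw [← L.measurePreserving.setIntegral_preimage_emb
      L.toHomeomorph.measurableEmbedding g (ball 0 1)]
    congr 2
    ext z
    simp
  rw [h1, ← integral_indicator measurableSet_ball, ← Complex.integral_comp_polarCoord_symm]
  have h2 : ∀ p ∈ polarCoord.target,
      p.1 • (ball (0 : ℂ) 1).indicator (fun z => g (L z)) (Complex.polarCoord.symm p) =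
        (Iio (1 : ℝ) ×ˢ (univ : Set ℝ)).indicator
          (fun p => p.1 * g (logPolar (log p.1) p.2)) p := by
    rintro ⟨r, θ⟩ hp
    have hr : 0 < r := hp.1
    have hnorm : ‖Complex.polarCoord.symm (r, θ)‖ = r := by
      rw [← L.norm_map, hL, orthonormalBasisOneI_repr_polarCoord_symm hr, norm_logPolar, exp_log hr]
    by_cases h : r < 1
    · rw [indicator_of_mem (by simpa [hnorm, abs_of_pos hr] using h),
        indicator_of_mem (by simpa using h), hL,
        orthonormalBasisOneI_repr_polarCoord_symm hr, smul_eq_mul]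
    · rw [indicator_of_notMem (by simpa [hnorm, abs_of_pos hr] using h),
        indicator_of_notMem (by simpa using h),
        smul_zero]
  rw [setIntegral_congr_fun polarCoord.open_target.measurableSet h2,
    setIntegral_indicator (measurableSet_Iio.prod MeasurableSet.univ)]
  congr 2
  rw [polarCoord_target, prod_inter_prod, inter_univ, Ioi_inter_Iio]

/-- An integral over the unit disk is bounded by any bound on a nonnegative function of `log r`
whose derivative is the integral over the circle of radius `r`. -/
lemma setIntegral_ball_le {g : Plane → ℝ} {m : ℝ → ℝ} {R : ℝ} (hR : 0 ≤ R)
    (hm : ∀ t < 0, HasDerivAt m (∫ θ in (-π)..π, exp t ^ 2 * g (logPolar t θ)) t)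
    (hm0 : ∀ t < 0, 0 ≤ m t) (hmR : ∀ t < 0, m t ≤ R) :
    ∫ y in ball (0 : Plane) 1, g y ≤ R := by
  rw [setIntegral_ball_eq_logPolar]
  by_cases hint : IntegrableOn (fun p : ℝ × ℝ => p.1 * g (logPolar (log p.1) p.2))
      (Ioo (0 : ℝ) 1 ×ˢ Ioo (-π) π)
  swap
  · rw [integral_undef hint]
    exact hR
  rw [Measure.volume_eq_prod, setIntegral_prod _ hint]
  set φ : ℝ → ℝ := fun r => ∫ θ in Ioo (-π) π, r * g (logPolar (log r) θ) with hφ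
  have hφint : IntegrableOn φ (Ioo 0 1) := by
    rw [IntegrableOn, Measure.volume_eq_prod, ← Measure.prod_restrict] at hint
    exact hint.integral_prod_left
  have hderiv : ∀ r ∈ Ioo (0 : ℝ) 1, HasDerivAt (fun r => m (log r)) (φ r) r := by
    intro r hr
    refine ((hm (log r) (log_neg hr.1 hr.2)).comp r (hasDerivAt_log hr.1.ne')).congr_deriv ?_
    rw [hφ, intervalIntegral.integral_of_le (by linarith [pi_pos]), integral_Ioc_eq_integral_Ioo,
      ← integral_mul_const]
    refine setIntegral_congr_fun measurableSet_Ioo fun θ _ => ?_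
    simp only [exp_log hr.1]
    field_simp [hr.1.ne']
  have hcover : AECover (volume.restrict (Ioo (0 : ℝ) 1)) Filter.atTop
      (fun n : ℕ => Ioc (1 / ((n : ℝ) + 1) / 2) (1 - 1 / ((n : ℝ) + 1) / 2)) := by
    have h := (tendsto_one_div_add_atTop_nhds_zero_nat (𝕜 := ℝ)).div_const 2
    refine aecover_Ioo_of_Ioc ?_ ?_
    · simpa using h
    · simpa using h.const_sub 1
  refine le_of_tendsto' (hcover.integral_tendsto_of_countably_generated hφint) fun n => ?_
  have hn : (0 : ℝ) < 1 / ((n : ℝ) + 1) := by positivity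
  have hn1 : 1 / ((n : ℝ) + 1) ≤ 1 := by
    rw [div_le_one (by positivity)]
    linarith [(Nat.cast_nonneg n : (0 : ℝ) ≤ n)]
  set a := 1 / ((n : ℝ) + 1) / 2 with ha
  have ha0 : 0 < a := by linarith
  have hab : a ≤ 1 - a := by linarith
  have hsub : Icc a (1 - a) ⊆ Ioo 0 1 := fun x hx => ⟨by linarith [hx.1], by linarith [hx.2]⟩
  rw [Measure.restrict_restrict measurableSet_Ioc,
    inter_eq_left.2 (Ioc_subset_Icc_self.trans hsub), ← intervalIntegral.integral_of_le hab,
    intervalIntegral.integral_eq_sub_of_hasDerivAt (f := fun r => m (log r))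
      (fun x hx => hderiv x (hsub (by rwa [uIcc_of_le hab] at hx)))
      ((intervalIntegrable_iff_integrableOn_Icc_of_le hab).2 (hφint.mono_set hsub))]
  have h1 := hm0 (log a) (log_neg ha0 (by linarith))
  have h2 := hmR (log (1 - a)) (log_neg (by linarith) (by linarith))
  linarith

/-- A solution of the singular Liouville equation on the punctured disk, written in logarithmic
polar coordinates. -/
lemma cylinderSolution_logPolar {α lam : ℝ} {K u : Plane → ℝ}
    (hu_C2 : ContDiffOn ℝ 2 u (ball (0 : Plane) 1 \ {0}))
    (heq : ∀ y ∈ ball (0 : Plane) 1 \ {0},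
      -lap u y = lam * ‖y‖ ^ (2 * α) * K y * Real.exp (u y)) :
    CylinderSolution (fun t θ => u (logPolar t θ))
      (fun t θ => partialDeriv 0 u (logPolar t θ) * (exp t * cos θ) +
        partialDeriv 1 u (logPolar t θ) * (exp t * sin θ))
      (fun t θ => -(partialDeriv 0 u (logPolar t θ) * (exp t * sin θ)) +
        partialDeriv 1 u (logPolar t θ) * (exp t * cos θ))
      (fun t θ =>
        ((partialDeriv 0 (partialDeriv 0 u) (logPolar t θ) * (exp t * cos θ) +
          partialDeriv 1 (partialDeriv 0 u) (logPolar t θ) * (exp t * sin θ)) * (exp t * cos θ) +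
          partialDeriv 0 u (logPolar t θ) * (exp t * cos θ)) +
        ((partialDeriv 0 (partialDeriv 1 u) (logPolar t θ) * (exp t * cos θ) +
          partialDeriv 1 (partialDeriv 1 u) (logPolar t θ) * (exp t * sin θ)) * (exp t * sin θ) +
          partialDeriv 1 u (logPolar t θ) * (exp t * sin θ)))
      (fun t θ =>
        -((-(partialDeriv 0 (partialDeriv 0 u) (logPolar t θ) * (exp t * sin θ)) +
          partialDeriv 1 (partialDeriv 0 u) (logPolar t θ) * (exp t * cos θ)) * (exp t * sin θ) +
          partialDeriv 0 u (logPolar t θ) * (exp t * cos θ)) +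
        ((-(partialDeriv 0 (partialDeriv 1 u) (logPolar t θ) * (exp t * sin θ)) +
          partialDeriv 1 (partialDeriv 1 u) (logPolar t θ) * (exp t * cos θ)) * (exp t * cos θ) +
          partialDeriv 1 u (logPolar t θ) * (exp t * -sin θ)))
      (fun t θ => lam * (exp t ^ 2 * (exp t ^ (2 * α) * K (logPolar t θ) *
        exp (u (logPolar t θ))))) := by
  have hpd := contDiffOn_partialDeriv hu_C2
  have hd : ∀ {g : Plane → ℝ} {n : WithTop ℕ∞}, n ≠ 0 → ContDiffOn ℝ n g (ball 0 1 \ {0}) →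
      ∀ t < 0, ∀ θ, DifferentiableAt ℝ g (logPolar t θ) := fun {g n} hn hg t ht θ =>
    (hg.contDiffAt (isOpen_punctured.mem_nhds (logPolar_mem ht θ))).differentiableAt hn
  have cu := continuousOn_comp_logPolar hu_C2.continuousOn
  have cpd := fun i => continuousOn_comp_logPolar (hpd i).continuousOn
  have cpd2 := fun i j => continuousOn_comp_logPolar (continuousOn_partialDeriv (hpd i) j)
  have cX : ContinuousOn (fun p : ℝ × ℝ => exp p.1 * cos p.2) (Iio 0 ×ˢ univ) := by fun_prop
  have cY : ContinuousOn (fun p : ℝ × ℝ => exp p.1 * sin p.2) (Iio 0 ×ˢ univ) := by fun_prop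
  simp only [Function.uncurry_def] at cu cpd cpd2
  have cpd0 := cpd 0
  have cpd1 := cpd 1
  have cpd00 := cpd2 0 0
  have cpd01 := cpd2 0 1
  have cpd10 := cpd2 1 0
  have cpd11 := cpd2 1 1
  have dX : ∀ t θ : ℝ, HasDerivAt (fun τ => exp τ * cos θ) (exp t * cos θ) t :=
    fun t θ => (Real.hasDerivAt_exp t).mul_const _
  have dY : ∀ t θ : ℝ, HasDerivAt (fun τ => exp τ * sin θ) (exp t * sin θ) t :=
    fun t θ => (Real.hasDerivAt_exp t).mul_const _
  have dX' : ∀ t θ : ℝ, HasDerivAt (fun φ => exp t * cos φ) (exp t * -sin θ) θ :=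
    fun t θ => (Real.hasDerivAt_cos θ).const_mul _
  have dY' : ∀ t θ : ℝ, HasDerivAt (fun φ => exp t * sin φ) (exp t * cos θ) θ :=
    fun t θ => (Real.hasDerivAt_sin θ).const_mul _
  exact
    { cont := cu
      cont_t := by
        simp only [Function.uncurry_def]
        fun_prop
      cont_s := by
        simp only [Function.uncurry_def]
        fun_prop
      cont_tt := by
        simp only [Function.uncurry_def]
        fun_prop
      cont_ss := by
        simp only [Function.uncurry_def]
        fun_prop
      deriv_t := fun t ht θ => hasDerivAt_comp_logPolar_left (hd two_ne_zero hu_C2 t ht θ)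
      deriv_s := fun t ht θ => hasDerivAt_comp_logPolar_right (hd two_ne_zero hu_C2 t ht θ)
      deriv_tt := fun t ht θ =>
        ((hasDerivAt_comp_logPolar_left (hd one_ne_zero (hpd 0) t ht θ)).mul (dX t θ)).add
          ((hasDerivAt_comp_logPolar_left (hd one_ne_zero (hpd 1) t ht θ)).mul (dY t θ))
      deriv_ss := fun t ht θ =>
        ((hasDerivAt_comp_logPolar_right (hd one_ne_zero (hpd 0) t ht θ)).mul (dY' t θ)).neg.add
          ((hasDerivAt_comp_logPolar_right (hd one_ne_zero (hpd 1) t ht θ)).mul (dX' t θ))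
      eqn := by
        intro t ht θ
        have h := heq _ (logPolar_mem ht θ)
        rw [lap_eq_partialDeriv, norm_logPolar] at h
        have hsc := cos_sq_add_sin_sq θ
        linear_combination (exp t ^ 2) * (-h) + exp t ^ 2 *
          (partialDeriv 0 (partialDeriv 0 u) (logPolar t θ) +
            partialDeriv 1 (partialDeriv 1 u) (logPolar t θ)) * hsc
      periodic := fun t θ => by rw [logPolar_periodic]
      periodic_f := fun t θ => by rw [logPolar_periodic] }

/-- A function that is `C¹` on the closed unit disk has bounded gradient on the open disk. -/
lemma bddAbove_norm_gradient {K : Plane → ℝ} (hK : ContDiffOn ℝ 1 K (closedBall (0 : Plane) 1)) :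
    BddAbove (range fun y : ball (0 : Plane) 1 => ‖gradient K (y : Plane)‖) := by
  have hint : (interior (closedBall (0 : Plane) 1)).Nonempty := by
    rw [interior_closedBall _ one_ne_zero]
    exact ⟨0, by simp⟩
  have hc := hK.continuousOn_fderivWithin
    (uniqueDiffOn_convex (convex_closedBall _ _) hint) le_rfl
  obtain ⟨M, hM⟩ := (isCompact_closedBall (0 : Plane) 1).exists_bound_of_continuousOn hc
  refine ⟨M, ?_⟩
  rintro _ ⟨⟨y, hy⟩, rfl⟩
  have := hM y (ball_subset_closedBall hy)
  rw [fderivWithin_of_mem_nhds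
    (Filter.mem_of_superset (isOpen_ball.mem_nhds hy) ball_subset_closedBall)] at this
  simpa [gradient] using this

/-- Explicit mass bound for the singular Liouville equation on the unit disk. -/
theorem mass_bound_liouville_disk (α lam : ℝ) (hα : -1 < α) (hlam : 0 < lam)
    (K : Plane → ℝ) (hK : ContDiffOn ℝ 1 K (closedBall (0 : Plane) 1))
    (hKpos : ∀ y ∈ closedBall (0 : Plane) 1, 0 < K y)
    (u : Plane → ℝ)
    (hu_cont : ContinuousOn u (closedBall (0 : Plane) 1))
    (hu_C2 : ContDiffOn ℝ 2 u (ball (0 : Plane) 1 \ {0}))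
    (heq : ∀ y ∈ ball (0 : Plane) 1 \ {0},
      -lap u y = lam * ‖y‖ ^ (2 * α) * K y * Real.exp (u y))
    (hbd : ∀ y ∈ sphere (0 : Plane) 1, u y = 0) :
    lam * ∫ y in ball (0 : Plane) 1, ‖y‖ ^ (2 * α) * K y * Real.exp (u y) ≤
      4 * π * (2 * (1 + α) +
        (⨆ y : ball (0 : Plane) 1, ‖gradient K ↑y‖) / (⨅ y : ball (0 : Plane) 1, K ↑y)) := by
  set s := ⨆ y : ball (0 : Plane) 1, ‖gradient K ↑y‖ with hs
  set k := ⨅ y : ball (0 : Plane) 1, K ↑y with hk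
  have S := cylinderSolution_logPolar hu_C2 heq
  have hcb : IsCompact (closedBall (0 : Plane) 1) := isCompact_closedBall _ _
  have hs0 : 0 ≤ s := Real.iSup_nonneg fun _ => norm_nonneg _
  have hgrad : ∀ y ∈ ball (0 : Plane) 1, ‖fderiv ℝ K y‖ ≤ s := by
    intro y hy
    have h : ‖gradient K y‖ ≤ s := le_ciSup (bddAbove_norm_gradient hK) ⟨y, hy⟩
    rwa [gradient, LinearIsometryEquiv.norm_map] at h
  have hk0 : 0 < k := by
    obtain ⟨y, hy, hmin⟩ := hcb.exists_isMinOn ⟨0, by simp⟩ hK.continuousOn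
    have : Nonempty (ball (0 : Plane) 1) := ⟨⟨0, by simp⟩⟩
    exact (hKpos y hy).trans_le (le_ciInf fun z => hmin (ball_subset_closedBall z.2))
  have hkK : ∀ y ∈ ball (0 : Plane) 1, k ≤ K y := by
    intro y hy
    refine ciInf_le (f := fun y : ball (0 : Plane) 1 => K ↑y) ⟨0, ?_⟩ ⟨y, hy⟩
    rintro _ ⟨z, rfl⟩
    exact (hKpos _ (ball_subset_closedBall z.2)).le
  have hC : 0 ≤ 2 * (1 + α) + s / k := add_nonneg (by linarith) (by positivity)
  obtain ⟨A, hA⟩ := hcb.exists_bound_of_continuousOn hu_cont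
  obtain ⟨M, hM⟩ := hcb.exists_bound_of_continuousOn hK.continuousOn
  have hmem : ∀ t < 0, ∀ θ, logPolar t θ ∈ closedBall (0 : Plane) 1 := fun t ht θ =>
    ball_subset_closedBall (logPolar_mem ht θ).1
  have hpow : ∀ t : ℝ, exp t ^ 2 * exp t ^ (2 * α) = exp ((2 * (1 + α)) * t) := by
    intro t
    rw [← exp_nat_mul, ← exp_mul, ← exp_add]
    congr 1
    push_cast
    ring
  have hKU : ContDiffOn ℝ 1 K (ball (0 : Plane) 1 \ {0}) :=
    hK.mono (sdiff_subset.trans ball_subset_closedBall)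
  have hKd : ∀ t < 0, ∀ θ, DifferentiableAt ℝ K (logPolar t θ) := fun t ht θ =>
    (hKU.contDiffAt (isOpen_punctured.mem_nhds (logPolar_mem ht θ))).differentiableAt one_ne_zero
  have hud : ∀ t < 0, ∀ θ, DifferentiableAt ℝ u (logPolar t θ) := fun t ht θ =>
    (hu_C2.contDiffAt (isOpen_punctured.mem_nhds (logPolar_mem ht θ))).differentiableAt two_ne_zero
  have cu := continuousOn_comp_logPolar hu_C2.continuousOn
  have cK := continuousOn_comp_logPolar hKU.continuousOn
  have cK0 := continuousOn_comp_logPolar (continuousOn_partialDeriv hKU 0)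
  have cK1 := continuousOn_comp_logPolar (continuousOn_partialDeriv hKU 1)
  have hpd := contDiffOn_partialDeriv hu_C2
  have cpd0 := continuousOn_comp_logPolar (hpd 0).continuousOn
  have cpd1 := continuousOn_comp_logPolar (hpd 1).continuousOn
  have cpd00 := continuousOn_comp_logPolar (continuousOn_partialDeriv (hpd 0) 0)
  have cpd01 := continuousOn_comp_logPolar (continuousOn_partialDeriv (hpd 0) 1)
  have cpd10 := continuousOn_comp_logPolar (continuousOn_partialDeriv (hpd 1) 0)
  have cpd11 := continuousOn_comp_logPolar (continuousOn_partialDeriv (hpd 1) 1)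
  have hpdd : ∀ i, ∀ t < 0, ∀ θ, DifferentiableAt ℝ (partialDeriv i u) (logPolar t θ) :=
    fun i t ht θ => ((hpd i).contDiffAt
      (isOpen_punctured.mem_nhds (logPolar_mem ht θ))).differentiableAt one_ne_zero
  simp only [Function.uncurry_def] at cu cK cK0 cK1 cpd0 cpd1 cpd00 cpd01 cpd10 cpd11
  have ceu : ContinuousOn (fun p : ℝ × ℝ => exp (u (logPolar p.1 p.2))) (Iio 0 ×ˢ univ) :=
    Real.continuous_exp.comp_continuousOn cu
  have cE : ContinuousOn (fun p : ℝ × ℝ => lam * exp ((2 * (1 + α)) * p.1)) (Iio 0 ×ˢ univ) := by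
    fun_prop
  have cX : ContinuousOn (fun p : ℝ × ℝ => exp p.1 * cos p.2) (Iio 0 ×ˢ univ) := by fun_prop
  have cY : ContinuousOn (fun p : ℝ × ℝ => exp p.1 * sin p.2) (Iio 0 ×ˢ univ) := by fun_prop
  have hf0 : ∀ t < 0, ∀ θ, 0 ≤ lam * (exp t ^ 2 * (exp t ^ (2 * α) * K (logPolar t θ) *
      exp (u (logPolar t θ)))) := by
    intro t ht θ
    have := hKpos _ (hmem t ht θ)
    positivity
  have hflux := S.flux_nonneg_and_le (A := A) (B := lam * M * exp A)
    (C := 2 * (1 + α) + s / k) (β := 2 * (1 + α))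
    (vts := fun t θ =>
      ((-(partialDeriv 0 (partialDeriv 0 u) (logPolar t θ) * (exp t * sin θ)) +
        partialDeriv 1 (partialDeriv 0 u) (logPolar t θ) * (exp t * cos θ)) * (exp t * cos θ) +
        partialDeriv 0 u (logPolar t θ) * (exp t * -sin θ)) +
      ((-(partialDeriv 0 (partialDeriv 1 u) (logPolar t θ) * (exp t * sin θ)) +
        partialDeriv 1 (partialDeriv 1 u) (logPolar t θ) * (exp t * cos θ)) * (exp t * sin θ) +
        partialDeriv 1 u (logPolar t θ) * (exp t * cos θ)))
    (q := fun t θ => lam * exp ((2 * (1 + α)) * t) * exp (u (logPolar t θ)) *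
      (2 * (1 + α) * K (logPolar t θ) + (partialDeriv 0 K (logPolar t θ) * (exp t * cos θ) +
        partialDeriv 1 K (logPolar t θ) * (exp t * sin θ))))
    (by
      simp only [Function.uncurry_def]
      fun_prop)
    (fun t ht θ =>
      ((hasDerivAt_comp_logPolar_right (hpdd 0 t ht θ)).mul
        ((Real.hasDerivAt_cos θ).const_mul _)).add
      ((hasDerivAt_comp_logPolar_right (hpdd 1 t ht θ)).mul
        ((Real.hasDerivAt_sin θ).const_mul _)))
    (by
      intro t ht θ
      refine (((hasDerivAt_comp_logPolar_left (hpdd 0 t ht θ)).mul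
        ((Real.hasDerivAt_exp t).mul_const (sin θ))).neg.add
        ((hasDerivAt_comp_logPolar_left (hpdd 1 t ht θ)).mul
        ((Real.hasDerivAt_exp t).mul_const (cos θ)))).congr_deriv ?_
      have hcomm := partialDeriv_comm hu_C2 (logPolar_mem ht θ) 0 1
      simp only [← partialDeriv.eq_def]
      rw [hcomm]
      ring)
    ((cE.mul ceu).mul (((continuousOn_const (c := 2 * (1 + α))).mul cK).add
      ((cK0.mul cX).add (cK1.mul cY))))
    (by
      intro t ht θ
      have hK' := hasDerivAt_comp_logPolar_left (hKd t ht θ)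
      have hu' := (hasDerivAt_comp_logPolar_left (hud t ht θ)).exp
      have he : HasDerivAt (fun τ : ℝ => exp ((2 * (1 + α)) * τ))
          (exp ((2 * (1 + α)) * t) * (2 * (1 + α))) t := by
        simpa using ((hasDerivAt_id t).const_mul (2 * (1 + α))).exp
      simp only [← partialDeriv.eq_def] at hK' hu'
      have h := ((he.mul hK').mul hu').const_mul lam
      simp only [mul_assoc (exp _ ^ (2 * α)), ← mul_assoc (exp _ ^ 2), hpow]
      refine (h.congr_of_eventuallyEq (Filter.Eventually.of_forall fun τ => ?_)).congr_deriv ?_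
      · simp only [Pi.mul_apply]
        ring
      · simp only [Pi.mul_apply]
        ring)
    (by linarith) hC (fun t ht θ => hA _ (hmem t ht θ)) hf0
    (by
      intro t ht θ
      rw [mul_assoc (exp _ ^ (2 * α)), ← mul_assoc (exp _ ^ 2), hpow]
      have h1 : K (logPolar t θ) ≤ M := (le_abs_self _).trans (hM _ (hmem t ht θ))
      have h2 : u (logPolar t θ) ≤ A := (le_abs_self _).trans (hA _ (hmem t ht θ))
      have h3 := hKpos _ (hmem t ht θ)
      have h4 : K (logPolar t θ) * exp (u (logPolar t θ)) ≤ M * exp A := by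
        gcongr
        exact h3.le.trans h1
      calc _ ≤ lam * (exp (2 * (1 + α) * t) * (M * exp A)) := by gcongr
        _ = _ := by ring)
    (by
      intro t ht θ
      have hy := (logPolar_mem ht θ).1
      have h1 : partialDeriv 0 K (logPolar t θ) * (exp t * cos θ) +
          partialDeriv 1 K (logPolar t θ) * (exp t * sin θ) ≤ s := by
        have : partialDeriv 0 K (logPolar t θ) * (exp t * cos θ) +
            partialDeriv 1 K (logPolar t θ) * (exp t * sin θ) =
            fderiv ℝ K (logPolar t θ) (logPolar t θ) := by
          conv_rhs => rw [logPolar.eq_def t θ, map_add, map_smul, map_smul, ← logPolar.eq_def]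
          simp only [smul_eq_mul, partialDeriv]
          ring
        rw [this]
        refine (le_abs_self _).trans (((fderiv ℝ K _).le_opNorm _).trans ?_)
        rw [norm_logPolar]
        calc _ ≤ s * 1 := mul_le_mul (hgrad _ hy) (exp_le_one_iff.2 ht.le) (exp_pos t).le hs0
          _ = s := mul_one s
      have h2 : s ≤ s / k * K (logPolar t θ) := by
        rw [div_mul_eq_mul_div, le_div_iff₀ hk0]
        exact mul_le_mul_of_nonneg_left (hkK _ hy) hs0
      rw [mul_assoc (exp _ ^ (2 * α)), ← mul_assoc (exp _ ^ 2), hpow]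
      calc _ ≤ lam * exp (2 * (1 + α) * t) * exp (u (logPolar t θ)) *
          (2 * (1 + α) * K (logPolar t θ) + s / k * K (logPolar t θ)) := by
            gcongr
            exact h1.trans h2
        _ = _ := by ring)
    (hu_cont.comp continuous_logPolar.continuousOn (by
      rintro ⟨t, θ⟩ ⟨ht, -⟩
      simpa [norm_logPolar] using ht))
    (fun θ => hbd _ (by simp [norm_logPolar]))
  rw [← integral_const_mul]
  exact setIntegral_ball_le (by positivity)
    (fun t ht => (S.hasDerivAt_flux ht).congr_deriv (intervalIntegral.integral_congr fun θ _ => by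
      simp only [norm_logPolar]
      ring))
    (fun t ht => (hflux t ht).1) (fun t ht => (hflux t ht).2)
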